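/- arXiv:1804.01358 — 3 statements merged into one kernel-verified Lean document; each statement's English description precedes it below -/
import Mathlib

section
/- Let n ≥ 2 and let A ∈ S_n be stationary diagonal, i.e. d_{i,j}(A) = 0 for all 1 ≤ i < j ≤ n. Then A is Jacobi diagonal (θ = 0 is a global maximum point of h_{i,j} for every 1 ≤ i < j ≤ n) if and only if for every pair 1 ≤ i < j ≤ n there exists a real number γ ∈ [−1, 1/3] such that A_{ijj} = γ A_{iii} and A_{iij} = γ A_{jjj}. -/
open scoped BigOperators
open Matrix

/-- Orthogonal transform of a third-order tensor by a matrix `Q`: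
`W i j k = ∑ p q r, A p q r * Q p i * Q q j * Q r k`. -/
def transform (n : ℕ) (A : Fin n → Fin n → Fin n → ℝ) (Q : Matrix (Fin n) (Fin n) ℝ) :
    Fin n → Fin n → Fin n → ℝ :=
  fun i j k => ∑ p, ∑ q, ∑ r, A p q r * Q p i * Q q j * Q r k

/-- The objective `f(Q) = ∑ i, W i i i ^ 2`. -/
def fObj (n : ℕ) (A : Fin n → Fin n → Fin n → ℝ) (Q : Matrix (Fin n) (Fin n) ℝ) : ℝ :=
  ∑ i, (transform n A Q i i i) ^ 2

/-- A third-order tensor is symmetric if its entries are invariant under all permutations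
of the indices (transpositions of adjacent indices suffice). -/
def IsSymT (n : ℕ) (A : Fin n → Fin n → Fin n → ℝ) : Prop :=
  ∀ i j k : Fin n, A i j k = A j i k ∧ A i j k = A i k j

/-- The Givens rotation `G^{(i,j,θ)}`. -/
noncomputable def givens (n : ℕ) (i j : Fin n) (θ : ℝ) : Matrix (Fin n) (Fin n) ℝ :=
  Matrix.of fun k l =>
    if k = l then (if k = i ∨ k = j then Real.cos θ else 1)
    else if k = j ∧ l = i then Real.sin θ
    else if k = i ∧ l = j then -Real.sin θ
    else 0

/-- `d_{i,j}(A)`. -/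
def dT (n : ℕ) (A : Fin n → Fin n → Fin n → ℝ) (i j : Fin n) : ℝ :=
  A i i i * A i i j - A i j j * A j j j

/-- `ω_{i,j}(A)`. -/
def ωT (n : ℕ) (A : Fin n → Fin n → Fin n → ℝ) (i j : Fin n) : ℝ :=
  A i i i ^ 2 + A j j j ^ 2 - 3 * A i i j ^ 2 - 3 * A i j j ^ 2
    - 2 * A i i i * A i j j - 2 * A i i j * A j j j

theorem aux_sum {n : ℕ} {i j : Fin n} (hij : i ≠ j) (v F : Fin n → ℝ)
    (hv : ∀ p, p ≠ i ∧ p ≠ j → v p = 0) : ∑ p, F p * v p = F i * v i + F j * v j :=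
  Fintype.sum_eq_add i j hij (fun p hp => by rw [hv p hp, mul_zero])

theorem aux_cube {n : ℕ} (A : Fin n → Fin n → Fin n → ℝ) (hA : IsSymT n A) {i j : Fin n}
    (hij : i ≠ j) (Q : Matrix (Fin n) (Fin n) ℝ) (k : Fin n)
    (hv : ∀ p, p ≠ i ∧ p ≠ j → Q p k = 0) :
    transform n A Q k k k = A i i i * Q i k ^ 3 + 3 * A i i j * Q i k ^ 2 * Q j k
      + 3 * A i j j * Q i k * Q j k ^ 2 + A j j j * Q j k ^ 3 := by
  have h1 : transform n A Q k k k
      = ∑ p, (∑ q, (∑ r, A p q r * Q r k) * Q q k) * Q p k := by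
    unfold transform
    refine Finset.sum_congr rfl fun p _ => ?_
    rw [Finset.sum_mul]
    refine Finset.sum_congr rfl fun q _ => ?_
    rw [Finset.sum_mul, Finset.sum_mul]
    refine Finset.sum_congr rfl fun r _ => ?_
    ring
  have key : ∀ F : Fin n → ℝ, ∑ p, F p * Q p k = F i * Q i k + F j * Q j k :=
    fun F => aux_sum hij (fun p => Q p k) F hv
  rw [h1]
  simp only [key]
  have e1 : A i j i = A i i j := (hA i j i).2
  have e2 : A j i i = A i i j := by rw [(hA j i i).1, e1]
  have e3 : A j i j = A i j j := (hA j i j).1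
  have e4 : A j j i = A i j j := by rw [(hA j j i).2, e3]
  rw [e1, e2, e3, e4]
  ring

theorem aux_diff {n : ℕ} (A : Fin n → Fin n → Fin n → ℝ) (hA : IsSymT n A) {i j : Fin n}
    (hij : i ≠ j) (hd : dT n A i j = 0) (θ : ℝ) :
    fObj n A (givens n i j θ) - fObj n A (givens n i j 0)
      = -3 * (Real.cos θ * Real.sin θ) ^ 2 * ωT n A i j := by
  have hji := hij.symm
  have hi : ∀ θ, transform n A (givens n i j θ) i i i = A i i i * Real.cos θ ^ 3
      + 3 * A i i j * Real.cos θ ^ 2 * Real.sin θ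
      + 3 * A i j j * Real.cos θ * Real.sin θ ^ 2 + A j j j * Real.sin θ ^ 3 := by
    intro θ
    rw [aux_cube A hA hij]
    · simp [givens, hji]
    · rintro p ⟨h1, h2⟩
      simp [givens, h1, h2]
  have hj : ∀ θ, transform n A (givens n i j θ) j j j = A i i i * (-Real.sin θ) ^ 3
      + 3 * A i i j * (-Real.sin θ) ^ 2 * Real.cos θ
      + 3 * A i j j * (-Real.sin θ) * Real.cos θ ^ 2 + A j j j * Real.cos θ ^ 3 := by
    intro θ
    rw [aux_cube A hA hij]
    · simp [givens, hij]
    · rintro p ⟨h1, h2⟩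
      simp [givens, h1, h2]
  have hk : ∀ k, k ≠ i ∧ k ≠ j → transform n A (givens n i j θ) k k k ^ 2
      - transform n A (givens n i j 0) k k k ^ 2 = 0 := by
    rintro k ⟨h1, h2⟩
    have : ∀ p, givens n i j θ p k = givens n i j 0 p k := by
      intro p
      by_cases hp : p = k
      · subst hp; simp [givens, h1, h2]
      · simp [givens, hp, h1, h2]
    simp only [transform, this, sub_self]
  unfold fObj
  rw [← Finset.sum_sub_distrib, Fintype.sum_eq_add i j hij hk, hi, hj, hi, hj]
  have hcs := Real.sin_sq_add_cos_sq θ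
  simp only [Real.cos_zero, Real.sin_zero]
  unfold ωT
  unfold dT at hd
  generalize Real.cos θ = x at *
  generalize Real.sin θ = y at *
  generalize A i i i = a at *
  generalize A i i j = b at *
  generalize A i j j = c at *
  generalize A j j j = d at *
  have e6 : x ^ 6 + y ^ 6 = 1 - 3 * (x * y) ^ 2 := by
    have : x ^ 6 + y ^ 6 = (y ^ 2 + x ^ 2) ^ 3 - 3 * (x * y) ^ 2 * (y ^ 2 + x ^ 2) := by ring
    rw [this, hcs]; ring
  linear_combination (a ^ 2 + d ^ 2) * e6 + 6 * (x ^ 5 * y - x * y ^ 5) * hd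
    + (9 * (b ^ 2 + c ^ 2) + 6 * (a * c + b * d)) * (x * y) ^ 2 * hcs

theorem aux_alg (a b c d : ℝ) (h : a * b - c * d = 0) :
    0 ≤ a ^ 2 + d ^ 2 - 3 * b ^ 2 - 3 * c ^ 2 - 2 * a * c - 2 * b * d ↔
      ∃ γ : ℝ, γ ∈ Set.Icc (-1 : ℝ) (1/3) ∧ c = γ * a ∧ b = γ * d := by
  constructor
  · intro hw
    by_cases h0 : a ^ 2 + d ^ 2 = 0
    · have ha : a = 0 := by nlinarith [sq_nonneg a, sq_nonneg d]
      have hd : d = 0 := by nlinarith [sq_nonneg a, sq_nonneg d]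
      subst ha hd
      refine ⟨0, by constructor <;> norm_num, ?_, ?_⟩ <;> nlinarith [sq_nonneg b, sq_nonneg c]
    · have hpos : 0 < a ^ 2 + d ^ 2 := lt_of_le_of_ne (by positivity) (Ne.symm h0)
      obtain ⟨g, hg⟩ : ∃ g, g = (a * c + b * d) / (a ^ 2 + d ^ 2) := ⟨_, rfl⟩
      have hc : c = g * a := by
        rw [hg]; field_simp; linear_combination (-d) * h
      have hb : b = g * d := by
        rw [hg]; field_simp; linear_combination a * h
      refine ⟨g, ?_, hc, hb⟩
      have h2 : 0 ≤ (a ^ 2 + d ^ 2) * ((1 - 3 * g) * (1 + g)) := by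
        rw [hc, hb] at hw
        linarith
      have h3 := nonneg_of_mul_nonneg_right h2 hpos
      constructor <;> nlinarith
  · rintro ⟨g, ⟨h1, h2⟩, rfl, rfl⟩
    have : 0 ≤ (a ^ 2 + d ^ 2) * ((1 - 3 * g) * (1 + g)) :=
      mul_nonneg (by positivity) (mul_nonneg (by linarith) (by linarith))
    linarith

/-- Theorem 3.19 / `theorem-gamma-charac`.
Let `A ∈ S_n` (`n ≥ 2`) be stationary diagonal, i.e. `d_{i,j}(A) = 0` for all `i < j`.
Then `A` is Jacobi diagonal iff for every pair `i < j` there is `γ ∈ [-1, 1/3]` with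
`A_{ijj} = γ A_{iii}` and `A_{iij} = γ A_{jjj}`. -/
theorem stmt_1 (n : ℕ) (hn : 2 ≤ n) (A : Fin n → Fin n → Fin n → ℝ) (hA : IsSymT n A)
    (hSD : ∀ i j : Fin n, i < j → dT n A i j = 0) :
    (∀ i j : Fin n, i < j →
        ∀ θ : ℝ, fObj n A (givens n i j θ) ≤ fObj n A (givens n i j 0)) ↔
      (∀ i j : Fin n, i < j → ∃ γ : ℝ, γ ∈ Set.Icc (-1 : ℝ) (1/3) ∧
        A i j j = γ * A i i i ∧ A i i j = γ * A j j j) := by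
  refine forall_congr' fun i => forall_congr' fun j => forall_congr' fun hij => ?_
  have hd := hSD i j hij
  have hdiff := aux_diff A hA hij.ne hd
  rw [← aux_alg _ _ _ _ hd]
  change _ ↔ 0 ≤ ωT n A i j
  constructor
  · intro h
    have h1 := h (Real.pi / 4)
    have h2 := hdiff (Real.pi / 4)
    rw [Real.cos_pi_div_four, Real.sin_pi_div_four] at h2
    have h3 : (√2 / 2 * (√2 / 2)) ^ 2 = (1 / 4 : ℝ) := by
      have := Real.sq_sqrt (show (0 : ℝ) ≤ 2 by norm_num)
      have h4 : √2 / 2 * (√2 / 2) = (1 / 2 : ℝ) := by linarith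
      rw [h4]; norm_num
    rw [h3] at h2
    linarith
  · intro h θ
    have := mul_nonneg (sq_nonneg (Real.cos θ * Real.sin θ)) h
    have := hdiff θ
    linarith
end

section
/- Let γ ∈ [−1, 1/3] and g ∈ ℝ, and let A ∈ S_3 be the symmetric tensor with A_{111} = A_{222} = A_{333} = 1, A_{122} = A_{112} = A_{133} = A_{113} = A_{233} = A_{223} = γ, and A_{123} = g. If (3/2)γ − 1/2 < g < −(9/2)γ² − (3/2)γ + 1, then A is locally maximally diagonal (the identity I₃ is a local maximum point of f over SO(3)). Moreover, if g < (3/2)γ − 1/2 or g > −(9/2)γ² − (3/2)γ + 1, then A is not locally maximally diagonal. -/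
open scoped BigOperators
open Matrix

/-- The special orthogonal group `SO(n)` as a set of matrices. -/
def SOset (n : ℕ) : Set (Matrix (Fin n) (Fin n) ℝ) :=
  {Q | Qᵀ * Q = 1 ∧ Q.det = 1}

/-- the cubic form -/
def cub (γ g x y z : ℝ) : ℝ :=
  x^3 + y^3 + z^3 + 3*γ*(x^2*y + x^2*z + y^2*x + y^2*z + z^2*x + z^2*y) + 6*g*x*y*z

def bB (γ g t D p q r : ℝ) : ℝ :=
  3*D^2*p + 3*D*t^2*p^2 + t^4*p^3
    + 3*γ*(2*D*t*p*(q+r) + t^3*p^2*(q+r) + (D+t^2*p)*(q^2+r^2) + t*(q^2*r+q*r^2))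
    + t*(q^3+r^3) + 6*g*(D+t^2*p)*q*r

def kK (γ g t D p q r : ℝ) : ℝ :=
  2*D^3*bB γ g t D p q r + (3*γ*D^2*(q+r) + t*bB γ g t D p q r)^2

lemma cub_sq (γ g t D p q r : ℝ) :
    cub γ g (D + t^2*p) (t*q) (t*r)^2 = D^6 + 6*γ*D^5*t*(q+r) + t^2 * kK γ g t D p q r := by
  have h : cub γ g (D + t^2*p) (t*q) (t*r)
      = D^3 + t*(3*γ*D^2*(q+r) + t*bB γ g t D p q r) := by
    unfold cub bB; ring
  rw [h]; unfold kK; ring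

lemma cub_swap (γ g x y z : ℝ) : cub γ g x y z = cub γ g y x z := by unfold cub; ring
lemma cub_rot (γ g x y z : ℝ) : cub γ g x y z = cub γ g z x y := by unfold cub; ring

def dD (a b c : ℝ) : ℝ := 1 + a^2 + b^2 + c^2

def rR (a b c : ℝ) : Matrix (Fin 3) (Fin 3) ℝ :=
  !![1+a^2-b^2-c^2, 2*(a*b-c), 2*(a*c+b);
     2*(a*b+c), 1-a^2+b^2-c^2, 2*(b*c-a);
     2*(a*c-b), 2*(b*c+a), 1-a^2-b^2+c^2]

def gG (γ g t a b c : ℝ) : ℝ :=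
  24*γ*(1+t^2*(a^2+b^2+c^2))^5*(a*b+b*c+c*a)
  + kK γ g t (1+t^2*(a^2+b^2+c^2)) (-2*(b^2+c^2)) (2*(t*a*b+c)) (2*(t*a*c-b))
  + kK γ g t (1+t^2*(a^2+b^2+c^2)) (-2*(a^2+c^2)) (2*(t*a*b-c)) (2*(t*b*c+a))
  + kK γ g t (1+t^2*(a^2+b^2+c^2)) (-2*(a^2+b^2)) (2*(t*a*c+b)) (2*(t*b*c-a))

def fC (γ g : ℝ) (Q : Matrix (Fin 3) (Fin 3) ℝ) : ℝ :=
  cub γ g (Q 0 0) (Q 1 0) (Q 2 0)^2 + cub γ g (Q 0 1) (Q 1 1) (Q 2 1)^2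
    + cub γ g (Q 0 2) (Q 1 2) (Q 2 2)^2

lemma key (γ g t a b c : ℝ) :
    fC γ g (rR (t*a) (t*b) (t*c)) = 3 * dD (t*a) (t*b) (t*c)^6 + t^2 * gG γ g t a b c := by
  have h1 := cub_sq γ g t (1+t^2*(a^2+b^2+c^2)) (-2*(b^2+c^2)) (2*(t*a*b+c)) (2*(t*a*c-b))
  have h2 := cub_sq γ g t (1+t^2*(a^2+b^2+c^2)) (-2*(a^2+c^2)) (2*(t*a*b-c)) (2*(t*b*c+a))
  have h3 := cub_sq γ g t (1+t^2*(a^2+b^2+c^2)) (-2*(a^2+b^2)) (2*(t*a*c+b)) (2*(t*b*c-a))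
  have e1 : cub γ g (rR (t*a) (t*b) (t*c) 0 0) (rR (t*a) (t*b) (t*c) 1 0)
      (rR (t*a) (t*b) (t*c) 2 0) = cub γ g ((1+t^2*(a^2+b^2+c^2)) + t^2*(-2*(b^2+c^2)))
        (t*(2*(t*a*b+c))) (t*(2*(t*a*c-b))) := by
    simp only [rR, Matrix.of_apply, Matrix.cons_val]
    congr 1 <;> ring
  have e2 : cub γ g (rR (t*a) (t*b) (t*c) 0 1) (rR (t*a) (t*b) (t*c) 1 1)
      (rR (t*a) (t*b) (t*c) 2 1) = cub γ g ((1+t^2*(a^2+b^2+c^2)) + t^2*(-2*(a^2+c^2)))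
        (t*(2*(t*a*b-c))) (t*(2*(t*b*c+a))) := by
    rw [cub_swap]
    simp only [rR, Matrix.of_apply, Matrix.cons_val]
    congr 1 <;> ring
  have e3 : cub γ g (rR (t*a) (t*b) (t*c) 0 2) (rR (t*a) (t*b) (t*c) 1 2)
      (rR (t*a) (t*b) (t*c) 2 2) = cub γ g ((1+t^2*(a^2+b^2+c^2)) + t^2*(-2*(a^2+b^2)))
        (t*(2*(t*a*c+b))) (t*(2*(t*b*c-a))) := by
    rw [cub_rot]
    simp only [rR, Matrix.of_apply, Matrix.cons_val]
    congr 1 <;> ring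
  have hD : dD (t*a) (t*b) (t*c) = 1+t^2*(a^2+b^2+c^2) := by unfold dD; ring
  unfold fC
  rw [e1, e2, e3, h1, h2, h3, hD]
  unfold gG
  ring

lemma gG_zero (γ g a b c : ℝ) : gG γ g 0 a b c =
    4 * ((-6 + 18*γ - 12*g) * ((a+b+c)^2/3)
      + (-6 + 9*γ + 27*γ^2 + 6*g) * (((a-b)^2+(b-c)^2+(c-a)^2)/3)) := by
  unfold gG kK bB; ring

lemma gG_cont (γ g : ℝ) :
    Continuous (fun z : ℝ × (ℝ × ℝ × ℝ) => gG γ g z.1 z.2.1 z.2.2.1 z.2.2.2) := by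
  unfold gG kK bB; fun_prop

attribute [irreducible] gG

lemma fC_smul (γ g s : ℝ) (Q : Matrix (Fin 3) (Fin 3) ℝ) :
    fC γ g (s • Q) = s^6 * fC γ g Q := by
  simp only [fC, cub, Matrix.smul_apply, smul_eq_mul]; ring

lemma dD_pos (a b c : ℝ) : 0 < dD a b c := by unfold dD; positivity

lemma rot_mem (a b c : ℝ) : (dD a b c)⁻¹ • rR a b c ∈ SOset 3 := by
  have h := (dD_pos a b c).ne'
  have h1 : (rR a b c)ᵀ * rR a b c = (dD a b c)^2 • (1 : Matrix (Fin 3) (Fin 3) ℝ) := by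
    ext i j
    fin_cases i <;> fin_cases j <;>
      simp [rR, dD, Matrix.mul_apply, Fin.sum_univ_three] <;> ring
  have h2 : (rR a b c).det = (dD a b c)^3 := by
    rw [Matrix.det_fin_three]
    simp [rR, dD]; ring
  refine ⟨?_, ?_⟩
  · rw [Matrix.transpose_smul, Matrix.smul_mul, Matrix.mul_smul, h1, smul_smul, smul_smul]
    rw [show (dD a b c)⁻¹ * (dD a b c)⁻¹ * (dD a b c)^2 = 1 by field_simp, one_smul]
  · rw [Matrix.det_smul, h2]
    simp only [Fintype.card_fin]
    field_simp

lemma cayley (Q : Matrix (Fin 3) (Fin 3) ℝ) (hQ : Q ∈ SOset 3)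
    (hT : 0 < 1 + Q 0 0 + Q 1 1 + Q 2 2) :
    Q = (dD ((Q 2 1 - Q 1 2) / (1 + Q 0 0 + Q 1 1 + Q 2 2))
            ((Q 0 2 - Q 2 0) / (1 + Q 0 0 + Q 1 1 + Q 2 2))
            ((Q 1 0 - Q 0 1) / (1 + Q 0 0 + Q 1 1 + Q 2 2)))⁻¹ •
        rR ((Q 2 1 - Q 1 2) / (1 + Q 0 0 + Q 1 1 + Q 2 2))
            ((Q 0 2 - Q 2 0) / (1 + Q 0 0 + Q 1 1 + Q 2 2))
            ((Q 1 0 - Q 0 1) / (1 + Q 0 0 + Q 1 1 + Q 2 2)) := by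
  obtain ⟨h1, hdet⟩ := hQ
  have h2 : Q * Qᵀ = 1 := mul_eq_one_comm.mp h1
  have h3 : Q.adjugate = Qᵀ := by
    calc Q.adjugate = Q.adjugate * (Q * Qᵀ) := by rw [h2, mul_one]
      _ = Qᵀ := by rw [← mul_assoc, Matrix.adjugate_mul, hdet, one_smul, one_mul]
  have c : ∀ i j, ∑ k, Q k i * Q k j = (1 : Matrix (Fin 3) (Fin 3) ℝ) i j := by
    intro i j; rw [← h1, Matrix.mul_apply]; rfl
  have r : ∀ i j, ∑ k, Q i k * Q j k = (1 : Matrix (Fin 3) (Fin 3) ℝ) i j := by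
    intro i j; rw [← h2, Matrix.mul_apply]; rfl
  have f : ∀ i j, Q.adjugate i j = Q j i := by
    intro i j; rw [h3]; rfl
  have c00 := c 0 0
  have c11 := c 1 1
  have c22 := c 2 2
  have c01 := c 0 1
  have c02 := c 0 2
  have c12 := c 1 2
  have r00 := r 0 0
  have r11 := r 1 1
  have r22 := r 2 2
  have r01 := r 0 1
  have r02 := r 0 2
  have r12 := r 1 2
  have f00 := f 0 0
  have f11 := f 1 1
  have f22 := f 2 2
  have f01 := f 0 1
  have f10 := f 1 0
  have f02 := f 0 2
  have f20 := f 2 0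
  have f12 := f 1 2
  have f21 := f 2 1
  clear c r f h1 h2 h3 hdet
  rw [Matrix.adjugate_fin_three] at *
  simp [Fin.sum_univ_three] at c00 c11 c22 c01 c02 c12 r00 r11 r22 r01 r02 r12 f00 f11 f22 f01 f10 f02 f20 f12 f21
  generalize h00 : Q 0 0 = q00 at *
  generalize h01 : Q 0 1 = q01 at *
  generalize h02 : Q 0 2 = q02 at *
  generalize h10 : Q 1 0 = q10 at *
  generalize h11 : Q 1 1 = q11 at *
  generalize h12 : Q 1 2 = q12 at *
  generalize h20 : Q 2 0 = q20 at *
  generalize h21 : Q 2 1 = q21 at *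
  generalize h22 : Q 2 2 = q22 at *
  obtain ⟨T, hTe⟩ : ∃ T, T = 1 + q00 + q11 + q22 := ⟨_, rfl⟩
  rw [← hTe]
  rw [← hTe] at hT
  have s1 : (q21-q12)^2 = (1+q00-q11-q22)*T := by
    rw [hTe]; linarith
  have s2 : (q02-q20)^2 = (1+q11-q00-q22)*T := by
    rw [hTe]; linarith
  have s3 : (q10-q01)^2 = (1+q22-q00-q11)*T := by
    rw [hTe]; linarith
  have s12 : (q21-q12)*(q02-q20) = (q01+q10)*T := by
    rw [hTe]; linarith
  have s13 : (q21-q12)*(q10-q01) = (q02+q20)*T := by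
    rw [hTe]; linarith
  have s23 : (q02-q20)*(q10-q01) = (q12+q21)*T := by
    rw [hTe]; linarith
  have hT0 := hT.ne'
  have n1 : ((q21-q12)/T)^2 = (1+q00-q11-q22)/T := by
    rw [div_pow, s1]; field_simp
  have n2 : ((q02-q20)/T)^2 = (1+q11-q00-q22)/T := by
    rw [div_pow, s2]; field_simp
  have n3 : ((q10-q01)/T)^2 = (1+q22-q00-q11)/T := by
    rw [div_pow, s3]; field_simp
  have n12 : ((q21-q12)/T)*((q02-q20)/T) = (q01+q10)/T := by
    rw [div_mul_div_comm, s12]; field_simp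
  have n13 : ((q21-q12)/T)*((q10-q01)/T) = (q02+q20)/T := by
    rw [div_mul_div_comm, s13]; field_simp
  have n23 : ((q02-q20)/T)*((q10-q01)/T) = (q12+q21)/T := by
    rw [div_mul_div_comm, s23]; field_simp
  have hD : dD ((q21-q12)/T) ((q02-q20)/T) ((q10-q01)/T) = 4 / T := by
    unfold dD; rw [n1, n2, n3]; field_simp; rw [hTe]; ring
  rw [hD]
  ext i j
  rw [Matrix.smul_apply]
  unfold rR
  rw [n1, n2, n3, n12, n13, n23]
  fin_cases i <;> fin_cases j <;>
    simp [h00, h01, h02, h10, h11, h12, h20, h21, h22] <;> field_simp <;> (try rw [hTe]) <;> ring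

lemma part_pos (γ g : ℝ) (h1 : 3/2 * γ - 1/2 < g) (h2 : g < -(9/2) * γ^2 - 3/2 * γ + 1) :
    ∃ δ > 0, ∀ a b c : ℝ, |a| < δ → |b| < δ → |c| < δ →
      fC γ g (rR a b c) ≤ 3 * dD a b c ^ 6 := by
  have hneg : ∀ u ∈ Metric.sphere (0 : ℝ × ℝ × ℝ) 1,
      ∀ᶠ z : (ℝ × ℝ × ℝ) × ℝ in nhds (u, 0), gG γ g z.2 z.1.1 z.1.2.1 z.1.2.2 < 0 := by
    rintro ⟨a, b, c⟩ hu
    have hc : Continuous (fun z : (ℝ × ℝ × ℝ) × ℝ => gG γ g z.2 z.1.1 z.1.2.1 z.1.2.2) :=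
      (gG_cont γ g).comp
        (continuous_snd.prodMk continuous_fst)
    refine hc.continuousAt.eventually_lt continuousAt_const ?_
    simp only [gG_zero]
    have hA : -6 + 18*γ - 12*g < 0 := by linarith
    have hB : -6 + 9*γ + 27*γ^2 + 6*g < 0 := by linarith
    have hN : 0 < a^2 + b^2 + c^2 := by
      by_contra hn
      have ha : a = 0 := by nlinarith [sq_nonneg a, sq_nonneg b, sq_nonneg c]
      have hb : b = 0 := by nlinarith [sq_nonneg a, sq_nonneg b, sq_nonneg c]
      have hc : c = 0 := by nlinarith [sq_nonneg a, sq_nonneg b, sq_nonneg c]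
      subst ha hb hc
      simp at hu
    rcases (sq_nonneg (a+b+c)).lt_or_eq with h | h
    · have := mul_neg_of_neg_of_pos hA (show 0 < (a+b+c)^2/3 by positivity)
      have := mul_nonpos_of_nonpos_of_nonneg hB.le
        (show 0 ≤ ((a-b)^2+(b-c)^2+(c-a)^2)/3 by positivity)
      linarith
    · rw [← h]
      have : 0 < ((a-b)^2+(b-c)^2+(c-a)^2)/3 := by nlinarith
      have := mul_neg_of_neg_of_pos hB this
      linarith
  have hev := (isCompact_sphere (0 : ℝ × ℝ × ℝ) 1).eventually_forall_of_forall_eventually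
    (x₀ := (0:ℝ)) (P := fun t u => gG γ g t u.1 u.2.1 u.2.2 < 0) (by
      intro u hu
      have := hneg u hu
      first
      | exact this
      | (rw [nhds_prod_eq] at *; exact this)
      | exact (continuous_swap.tendsto ((0:ℝ), u)).eventually this)
  obtain ⟨δ, hδ, hd⟩ := Metric.eventually_nhds_iff.mp hev
  refine ⟨δ, hδ, fun a b c ha hb hc => ?_⟩
  set v : ℝ × ℝ × ℝ := (a, b, c) with hv
  by_cases h0 : v = 0
  · simp only [hv, Prod.mk_eq_zero] at h0
    obtain ⟨rfl, rfl, rfl⟩ := h0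
    have := key γ g 0 0 0 0
    simp at this
    simp [this]
  · have ht : 0 < ‖v‖ := norm_pos_iff.mpr h0
    have hlt : ‖v‖ < δ := by
      simp only [hv, Prod.norm_def, Real.norm_eq_abs]
      exact max_lt ha (max_lt hb hc)
    have hk := hd (y := ‖v‖) (by simpa using hlt) (‖v‖⁻¹ • v) (by
      simp [norm_smul, ht.ne'])
    have := key γ g ‖v‖ (‖v‖⁻¹ • v).1 (‖v‖⁻¹ • v).2.1 (‖v‖⁻¹ • v).2.2
    have e1 : ‖v‖ * (‖v‖⁻¹ • v).1 = a := mul_inv_cancel_left₀ ht.ne' _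
    have e2 : ‖v‖ * (‖v‖⁻¹ • v).2.1 = b := mul_inv_cancel_left₀ ht.ne' _
    have e3 : ‖v‖ * (‖v‖⁻¹ • v).2.2 = c := mul_inv_cancel_left₀ ht.ne' _
    rw [e1, e2, e3] at this
    rw [this]
    have := mul_neg_of_pos_of_neg (pow_pos ht 2) hk
    linarith

lemma fObj_eq (γ g : ℝ) 
    (A : Fin 3 → Fin 3 → Fin 3 → ℝ) (hA : IsSymT 3 A)
    (h111 : A 0 0 0 = 1) (h222 : A 1 1 1 = 1) (h333 : A 2 2 2 = 1)
    (h122 : A 0 1 1 = γ) (h112 : A 0 0 1 = γ)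
    (h133 : A 0 2 2 = γ) (h113 : A 0 0 2 = γ)
    (h233 : A 1 2 2 = γ) (h223 : A 1 1 2 = γ)
    (h123 : A 0 1 2 = g) : fObj 3 A = fC γ g := by
  have s1 : ∀ i j k, A i j k = A j i k := fun i j k => (hA i j k).1
  have s2 : ∀ i j k, A i j k = A i k j := fun i j k => (hA i j k).2
  have a010 : A 0 1 0 = γ := by rw [s2, h112]
  have a100 : A 1 0 0 = γ := by rw [s1, a010]
  have a101 : A 1 0 1 = γ := by rw [s1, h122]
  have a110 : A 1 1 0 = γ := by rw [s2, a101]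
  have a020 : A 0 2 0 = γ := by rw [s2, h113]
  have a200 : A 2 0 0 = γ := by rw [s1, a020]
  have a202 : A 2 0 2 = γ := by rw [s1, h133]
  have a220 : A 2 2 0 = γ := by rw [s2, a202]
  have a121 : A 1 2 1 = γ := by rw [s2, h223]
  have a211 : A 2 1 1 = γ := by rw [s1, a121]
  have a212 : A 2 1 2 = γ := by rw [s1, h233]
  have a221 : A 2 2 1 = γ := by rw [s2, a212]
  have a021 : A 0 2 1 = g := by rw [s2, h123]
  have a102 : A 1 0 2 = g := by rw [s1, h123]
  have a120 : A 1 2 0 = g := by rw [s2, a102]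
  have a201 : A 2 0 1 = g := by rw [s1, a021]
  have a210 : A 2 1 0 = g := by rw [s2, a201]
  have ht : ∀ (Q : Matrix (Fin 3) (Fin 3) ℝ) i,
      transform 3 A Q i i i = cub γ g (Q 0 i) (Q 1 i) (Q 2 i) := by
    intro Q i
    simp only [transform, Fin.sum_univ_three, cub, *]
    ring
  funext Q
  simp only [fObj, ht, Fin.sum_univ_three, fC]

lemma fC_one (γ g : ℝ) : fC γ g 1 = 3 := by
  simp [fC, cub]; norm_num

lemma part_neg (γ g a b c : ℝ) (h : 0 < gG γ g 0 a b c) :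
    ¬ IsLocalMaxOn (fC γ g) (SOset 3) 1 := by
  intro hm
  have hdc : Continuous (fun t : ℝ => dD (t*a) (t*b) (t*c)) := by unfold dD; fun_prop
  have hrc : Continuous (fun t : ℝ => rR (t*a) (t*b) (t*c)) := by
    unfold rR
    refine continuous_matrix fun i j => ?_
    fin_cases i <;> fin_cases j <;> simp <;> fun_prop
  have hc : Continuous (fun t : ℝ => (dD (t*a) (t*b) (t*c))⁻¹ • rR (t*a) (t*b) (t*c)) :=
    (hdc.inv₀ fun t => (dD_pos _ _ _).ne').smul hrc
  have h1 : (dD (0*a) (0*b) (0*c))⁻¹ • rR (0*a) (0*b) (0*c) = 1 := by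
    ext i j
    fin_cases i <;> fin_cases j <;> simp [dD, rR]
  have htend : Filter.Tendsto (fun t : ℝ => (dD (t*a) (t*b) (t*c))⁻¹ • rR (t*a) (t*b) (t*c))
      (nhds 0) (nhdsWithin 1 (SOset 3)) := by
    refine tendsto_nhdsWithin_iff.mpr ⟨?_, Filter.Eventually.of_forall fun t => rot_mem _ _ _⟩
    have := hc.tendsto 0
    rwa [h1] at this
  have e1 := htend.eventually hm
  have e2 : ∀ᶠ t : ℝ in nhds 0, 0 < gG γ g t a b c := by
    have : Continuous (fun t : ℝ => gG γ g t a b c) := by unfold gG kK bB; fun_prop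
    exact continuousAt_const.eventually_lt this.continuousAt h
  obtain ⟨t, ⟨ht1, ht2⟩, ht0⟩ := (((e1.and e2).filter_mono nhdsWithin_le_nhds).and
    (self_mem_nhdsWithin (a := (0:ℝ)) (s := {0}ᶜ))).exists
  rw [fC_smul, fC_one, key] at ht1
  have hD := dD_pos (t*a) (t*b) (t*c)
  have ht0' : t ≠ 0 := ht0
  have : 0 < t^2 * gG γ g t a b c := by positivity
  have h6 := pow_pos hD 6
  rw [inv_pow, inv_mul_le_iff₀ h6] at ht1
  linarith

/-- Example 4.5 / `LC2-charact-01`.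
Let `γ ∈ [-1, 1/3]`, `g ∈ ℝ` and let `A ∈ S_3` have unit diagonal `A_{111} = A_{222} =
A_{333} = 1`, entries `A_{122} = A_{112} = A_{133} = A_{113} = A_{233} = A_{223} = γ`
and `A_{123} = g`. If `3γ/2 − 1/2 < g < −9γ²/2 − 3γ/2 + 1` then `A` is locally maximally
diagonal; if `g < 3γ/2 − 1/2` or `g > −9γ²/2 − 3γ/2 + 1` then it is not. -/
theorem stmt_7 (γ g : ℝ) (hγ : γ ∈ Set.Icc (-1 : ℝ) (1/3))
    (A : Fin 3 → Fin 3 → Fin 3 → ℝ) (hA : IsSymT 3 A)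
    (h111 : A 0 0 0 = 1) (h222 : A 1 1 1 = 1) (h333 : A 2 2 2 = 1)
    (h122 : A 0 1 1 = γ) (h112 : A 0 0 1 = γ)
    (h133 : A 0 2 2 = γ) (h113 : A 0 0 2 = γ)
    (h233 : A 1 2 2 = γ) (h223 : A 1 1 2 = γ)
    (h123 : A 0 1 2 = g) :
    ((3/2 * γ - 1/2 < g ∧ g < -(9/2) * γ^2 - 3/2 * γ + 1) →
      IsLocalMaxOn (fObj 3 A) (SOset 3) 1) ∧
    ((g < 3/2 * γ - 1/2 ∨ -(9/2) * γ^2 - 3/2 * γ + 1 < g) →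
      ¬ IsLocalMaxOn (fObj 3 A) (SOset 3) 1) := by
  rw [fObj_eq γ g A hA h111 h222 h333 h122 h112 h133 h113 h233 h223 h123]
  refine ⟨fun ⟨h1, h2⟩ => ?_, fun h => ?_⟩
  · obtain ⟨δ, hδ, H⟩ := part_pos γ g h1 h2
    have ent : ∀ i j, Continuous (fun Q : Matrix (Fin 3) (Fin 3) ℝ => Q i j) :=
      fun i j => continuous_id.matrix_elem i j
    have cT : Continuous (fun Q : Matrix (Fin 3) (Fin 3) ℝ => 1 + Q 0 0 + Q 1 1 + Q 2 2) :=
      ((continuous_const.add (ent 0 0)).add (ent 1 1)).add (ent 2 2)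
    have eT : ∀ᶠ Q : Matrix (Fin 3) (Fin 3) ℝ in nhds 1, 0 < 1 + Q 0 0 + Q 1 1 + Q 2 2 :=
      continuousAt_const.eventually_lt cT.continuousAt (by simp; norm_num)
    have es : ∀ i j : Fin 3, i ≠ j → ∀ᶠ Q : Matrix (Fin 3) (Fin 3) ℝ in nhds 1,
        |(Q i j - Q j i) / (1 + Q 0 0 + Q 1 1 + Q 2 2)| < δ := by
      intro i j hij
      refine ContinuousAt.eventually_lt (ContinuousAt.abs (ContinuousAt.div
        ((ent i j).sub (ent j i)).continuousAt cT.continuousAt (by simp; norm_num)))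
        continuousAt_const ?_
      simpa [hij, hij.symm] using hδ
    have e1 := es 2 1 (by decide)
    have e2 := es 0 2 (by decide)
    have e3 := es 1 0 (by decide)
    have hall := (eT.and (e1.and (e2.and e3)))
    have hw := hall.filter_mono (nhdsWithin_le_nhds (s := SOset 3))
    filter_upwards [hw, self_mem_nhdsWithin] with Q ⟨q0, q1, q2, q3⟩ hQ
    rw [fC_one, cayley Q hQ q0, fC_smul]
    have hD := pow_pos (dD_pos ((Q 2 1 - Q 1 2) / (1 + Q 0 0 + Q 1 1 + Q 2 2))
            ((Q 0 2 - Q 2 0) / (1 + Q 0 0 + Q 1 1 + Q 2 2))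
            ((Q 1 0 - Q 0 1) / (1 + Q 0 0 + Q 1 1 + Q 2 2))) 6
    rw [inv_pow, inv_mul_le_iff₀ hD, mul_comm]
    exact H _ _ _ q1 q2 q3
  · rcases h with h | h
    · refine part_neg γ g 1 1 1 ?_
      rw [gG_zero]; linarith
    · refine part_neg γ g 1 (-1) 0 ?_
      rw [gG_zero]; linarith
end

section
/- A symmetric tensor that lies in the orbit of diagonal tensors under independent orthogonal transformations in the three modes is orthogonally decomposable: O(D_n) = S_n ∩ GO(D_n). That is, if A ∈ S_n and there exist a diagonal tensor Λ ∈ S_n and P, Q, R ∈ O(n) such that A_{ijk} = Σ_{p,q,r} Λ_{pqr} P_{pi} Q_{qj} R_{rk}, then there exist μ_k ∈ ℝ and an orthonormal basis u_1, …, u_n of ℝⁿ with A = Σ_{k=1}^n μ_k u_k ⊗ u_k ⊗ u_k; conversely every orthogonally decomposable tensor lies in S_n ∩ GO(D_n). -/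
open scoped BigOperators
open Matrix

/-- A family `u : Fin n → (Fin n → ℝ)` is an orthonormal basis of `ℝⁿ`. -/
def OrthonormalFam (n : ℕ) (u : Fin n → Fin n → ℝ) : Prop :=
  ∀ i j : Fin n, (∑ p, u i p * u j p) = if i = j then 1 else 0

/-- `O(D_n)`: the orthogonally decomposable tensors. -/
def OdecoSet (n : ℕ) : Set (Fin n → Fin n → Fin n → ℝ) :=
  {A | ∃ lam : Fin n → ℝ, ∃ u : Fin n → Fin n → ℝ, OrthonormalFam n u ∧
    ∀ i j k : Fin n, A i j k = ∑ l, lam l * u l i * u l j * u l k}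

/-- `GO(D_n)`: tensors obtained from a diagonal tensor by independent orthogonal
transformations in the three modes. -/
def GODiagSet (n : ℕ) : Set (Fin n → Fin n → Fin n → ℝ) :=
  {A | ∃ Λ : Fin n → Fin n → Fin n → ℝ,
    (∀ p q r : Fin n, (p ≠ q ∨ q ≠ r) → Λ p q r = 0) ∧
    ∃ P Q R : Matrix (Fin n) (Fin n) ℝ,
      Pᵀ * P = 1 ∧ Qᵀ * Q = 1 ∧ Rᵀ * R = 1 ∧
      ∀ i j k : Fin n, A i j k = ∑ p, ∑ q, ∑ r, Λ p q r * P p i * Q q j * R r k}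

lemma aux_contract (n : ℕ) (lam : Fin n → ℝ) (P Q R : Fin n → Fin n → ℝ)
    (hP : OrthonormalFam n P) (hQ : OrthonormalFam n Q)
    (hS : ∀ i j k, (∑ l, lam l * P l i * Q l j * R l k) = ∑ l, lam l * P l i * Q l k * R l j)
    (l k : Fin n) : lam l * R l k = lam l * (∑ j, Q l j * R l j) * Q l k := by
  have key : ∀ j k, (∑ i, P l i * ∑ m, lam m * P m i * Q m j * R m k)
      = lam l * Q l j * R l k := by
    intro j k
    simp_rw [Finset.mul_sum]
    rw [Finset.sum_comm]
    have : ∀ m, (∑ i, P l i * (lam m * P m i * Q m j * R m k))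
        = (if l = m then 1 else 0) * (lam m * Q m j * R m k) := by
      intro m
      rw [← hP l m, Finset.sum_mul]
      exact Finset.sum_congr rfl fun i _ => by ring
    simp [this]
  have h2 : ∀ j, lam l * Q l j * R l k = lam l * Q l k * R l j := by
    intro j
    rw [← key j k, ← key k j]
    exact Finset.sum_congr rfl fun i _ => by rw [hS]
  have h1 := hQ l l
  rw [if_pos rfl] at h1
  calc lam l * R l k = (∑ j, Q l j * Q l j) * (lam l * R l k) := by rw [h1, one_mul]
    _ = ∑ j, Q l j * (lam l * Q l j * R l k) := by
      rw [Finset.sum_mul]; exact Finset.sum_congr rfl fun i _ => by ring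
    _ = ∑ j, Q l j * (lam l * Q l k * R l j) := by simp_rw [h2]
    _ = _ := by
      rw [Finset.mul_sum, Finset.sum_mul]; exact Finset.sum_congr rfl fun i _ => by ring

lemma aux_orth (n : ℕ) (P : Matrix (Fin n) (Fin n) ℝ) : Pᵀ * P = 1 ↔ OrthonormalFam n P := by
  rw [mul_eq_one_comm, ← Matrix.ext_iff]
  simp only [OrthonormalFam, Matrix.mul_apply, Matrix.transpose_apply, Matrix.one_apply]

lemma aux_diag (n : ℕ) (Λ : Fin n → Fin n → Fin n → ℝ)
    (h : ∀ p q r : Fin n, (p ≠ q ∨ q ≠ r) → Λ p q r = 0) (P Q R : Matrix (Fin n) (Fin n) ℝ)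
    (i j k : Fin n) : (∑ p, ∑ q, ∑ r, Λ p q r * P p i * Q q j * R r k)
      = ∑ p, Λ p p p * P p i * Q p j * R p k := by
  refine Finset.sum_congr rfl fun p _ => ?_
  rw [Finset.sum_eq_single p, Finset.sum_eq_single p]
  · intro r _ hr
    simp [h p p r (Or.inr hr.symm)]
  · simp
  · intro q _ hq
    exact Finset.sum_eq_zero fun r _ => by simp [h p q r (Or.inl hq.symm)]
  · simp

/-- Corollary 5.9 / `corollary-analogue-Comon`.
`O(D_n) = S_n ∩ GO(D_n)`: a symmetric tensor lying in the orbit of diagonal tensors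
under independent orthogonal transformations in the three modes is orthogonally
decomposable, and conversely. -/
theorem stmt_15 (n : ℕ) :
    OdecoSet n = {A | IsSymT n A} ∩ GODiagSet n := by
  ext A
  constructor
  · rintro ⟨lam, u, hu, hA⟩
    have hd : ∀ p q r : Fin n, (p ≠ q ∨ q ≠ r) →
        (fun p q r : Fin n => if p = q ∧ q = r then lam p else 0) p q r = 0 := by
      intro p q r h
      exact if_neg (by tauto)
    refine ⟨?_, fun p q r => if p = q ∧ q = r then lam p else 0, hd, u, u, u,
      (aux_orth n u).2 hu, (aux_orth n u).2 hu, (aux_orth n u).2 hu, ?_⟩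
    · intro i j k
      simp only [hA]
      exact ⟨Finset.sum_congr rfl fun _ _ => by ring, Finset.sum_congr rfl fun _ _ => by ring⟩
    · intro i j k
      refine Eq.trans ?_ (aux_diag n _ hd u u u i j k).symm
      simp [hA]
  · rintro ⟨hS, Λ, hΛ, P, Q, R, hP, hQ, hR, hA⟩
    rw [aux_orth] at hP hQ hR
    simp only [aux_diag n Λ hΛ] at hA
    have h1 := aux_contract n (fun l => Λ l l l) P Q R hP hQ
      (fun i j k => by rw [← hA, ← hA]; exact (hS i j k).2)
    have h2 := aux_contract n (fun l => Λ l l l) R Q P hR hQ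
      (fun i j k => by
        have h3 : A k j i = A j k i := (hS k j i).1
        rw [hA, hA] at h3
        refine Eq.trans (Finset.sum_congr rfl fun _ _ => by ring)
          (h3.trans (Finset.sum_congr rfl fun _ _ => by ring)))
    refine ⟨fun l => Λ l l l * (∑ j, Q l j * R l j) * (∑ j, Q l j * P l j), Q, hQ, ?_⟩
    intro i j k
    rw [hA]
    refine Finset.sum_congr rfl fun l _ => ?_
    have a := h1 l k
    have b := h2 l i
    linear_combination (Q l j * R l k) * b + ((∑ j, Q l j * P l j) * Q l i * Q l j) * a
end
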